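/- Invariance of the invariants: for every permutation σ of S_n and each of the four Rauzy moves T ∈ {L, L′, R, R′}, the cycle invariant and the sign invariant are preserved: λ(T(σ)) = λ(σ) and s(T(σ)) = s(σ). Consequently all permutations in the same extended Rauzy class have the same pair of invariants (λ, s). -/

import Mathlib

namespace Rauzy

/-- Darts: `Sum.inl i` is the bottom point of (0-indexed) position `i`,
`Sum.inr j` is the top point of (0-indexed) position `j`. -/
abbrev Darts (n : ℕ) := Fin n ⊕ Fin n

/-- The chord involution of the diagram of `σ`: bottom point `i` ↔ top point `σ i`. -/
def chordInv {n : ℕ} (σ : Equiv.Perm (Fin n)) : Equiv.Perm (Darts n) :=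
  (Equiv.sumCongr (σ : Fin n ≃ Fin n) (σ⁻¹ : Fin n ≃ Fin n)).trans (Equiv.sumComm _ _)

/-- Coding of the `2n` points, in clockwise order `b_1, …, b_n, t_n, …, t_1`, by `Fin (n + n)`. -/
def circCode (n : ℕ) : Darts n ≃ Fin (n + n) :=
  (Equiv.sumCongr (Equiv.refl (Fin n)) (Fin.revPerm : Equiv.Perm (Fin n))).trans finSumFinEquiv

/-- Clockwise successor among the `2n` circle points. -/
def nextPoint (n : ℕ) : Equiv.Perm (Darts n) :=
  ((circCode n).trans (finRotate (n + n))).trans (circCode n).symm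

/-- The face (boundary walk) permutation of the one-vertex ribbon graph whose chords are
the edges of `σ`; the faces of the ribbon graph are the orbits of this permutation. -/
def facePerm {n : ℕ} (σ : Equiv.Perm (Fin n)) : Equiv.Perm (Darts n) :=
  (chordInv σ).trans (nextPoint n)

/-- The step made from dart `p` traverses the circle arc whose clockwise starting point is
`chordInv σ p`; this arc is one of the `n - 1` (proper) top arcs exactly when that point is a
top point other than the leftmost one. -/
def isTopStart {n : ℕ} (σ : Equiv.Perm (Fin n)) (p : Darts n) : Bool :=
  match chordInv σ p with
  | Sum.inl _ => false
  | Sum.inr j => decide (1 ≤ (j : ℕ))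

/-- The face (orbit of the face permutation) containing the dart `p`. -/
def faceOf {n : ℕ} (σ : Equiv.Perm (Fin n)) (p : Darts n) : Finset (Darts n) :=
  Finset.univ.filter fun q => ∃ k : Fin (n + n), ((facePerm σ) ^ (k : ℕ)) p = q

/-- The length of a face: the number of top arcs on its boundary. -/
def faceLen {n : ℕ} (σ : Equiv.Perm (Fin n)) (F : Finset (Darts n)) : ℕ :=
  (F.filter fun q => isTopStart σ q = true).card

/-- The cycle invariant `λ(σ)`: the multiset of the lengths of the cycles (faces) of `σ`. -/
def cycleInv {n : ℕ} (σ : Equiv.Perm (Fin n)) : Multiset ℕ :=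
  (Finset.univ.image fun p => faceOf σ p).val.map (faceLen σ)

/-- `χ(S)`: the number of pairs `i < j` in `S` with `σ i > σ j`. -/
def inversions {n : ℕ} (σ : Equiv.Perm (Fin n)) (S : Finset (Fin n)) : ℕ :=
  ((S ×ˢ S).filter fun p => p.1 < p.2 ∧ σ p.2 < σ p.1).card

/-- `A(σ) = Σ_{S ⊆ {1,…,n}} (-1)^{|S| + χ(S)}`. -/
def signSum {n : ℕ} (σ : Equiv.Perm (Fin n)) : ℤ :=
  ∑ S : Finset (Fin n), (-1 : ℤ) ^ (S.card + inversions σ S)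

/-- The sign invariant `s(σ) ∈ {-1, 0, 1}`. -/
def signInv {n : ℕ} (σ : Equiv.Perm (Fin n)) : ℤ := (signSum σ).sign

/-- The permutation of the values which fixes `v ≤ a`, sends `v ↦ v + 1` for
`a < v < n` and the largest value to `a + 1` (the identity if `a` is the largest value). -/
def topCycle {n : ℕ} (a : Fin (n + 1)) : Equiv.Perm (Fin (n + 1)) :=
  if a = Fin.last n then 1
  else (Equiv.addLeft (a + 1)).permCongr (Fin.cycleRange (Fin.last n - (a + 1)))

/-- The Rauzy move `L`. -/
def moveL : {n : ℕ} → Equiv.Perm (Fin n) → Equiv.Perm (Fin n)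
  | 0, σ => σ
  | (k + 1), σ => topCycle (σ (Fin.last k)) * σ

/-- The Rauzy move `L'`. -/
def moveL' : {n : ℕ} → Equiv.Perm (Fin n) → Equiv.Perm (Fin n)
  | 0, σ => σ
  | (k + 1), σ => σ * (topCycle (σ⁻¹ (Fin.last k)))⁻¹

/-- Rotation of the diagram by 180 degrees: `rot(σ)(i) = n + 1 - σ⁻¹(n + 1 - i)`. -/
def rotD {n : ℕ} (σ : Equiv.Perm (Fin n)) : Equiv.Perm (Fin n) :=
  (Fin.revPerm : Equiv.Perm (Fin n)) * σ⁻¹ * (Fin.revPerm : Equiv.Perm (Fin n))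

/-- The Rauzy move `R = rot ∘ L ∘ rot`. -/
def moveR {n : ℕ} (σ : Equiv.Perm (Fin n)) : Equiv.Perm (Fin n) := rotD (moveL (rotD σ))

/-- The Rauzy move `R' = rot ∘ L' ∘ rot`. -/
def moveR' {n : ℕ} (σ : Equiv.Perm (Fin n)) : Equiv.Perm (Fin n) := rotD (moveL' (rotD σ))

/-- One step of the extended Rauzy dynamics. -/
def RauzyStep {n : ℕ} (σ τ : Equiv.Perm (Fin n)) : Prop :=
  τ = moveL σ ∨ τ = moveL' σ ∨ τ = moveR σ ∨ τ = moveR' σ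

/-- Two permutations are connected (are in the same class) under the extended Rauzy dynamics. -/
def RauzyConnected {n : ℕ} (σ τ : Equiv.Perm (Fin n)) : Prop :=
  Relation.EqvGen RauzyStep σ τ

/-- The exceptional class is the class of the identity permutation. -/
def Exceptional {n : ℕ} (σ : Equiv.Perm (Fin n)) : Prop := RauzyConnected σ 1

/-- Reduction of `σ` by the edge `(i, σ i)`: delete bottom point `i` and top point `σ i`
and renumber the remaining points in order. -/
def reduceAt {n : ℕ} (σ : Equiv.Perm (Fin (n + 1))) (i : Fin (n + 1)) : Equiv.Perm (Fin n) :=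
  Equiv.removeNone
    (((finSuccEquiv' i).symm.trans (σ : Fin (n + 1) ≃ Fin (n + 1))).trans (finSuccEquiv' (σ i)))

/-- Insertion of one new edge in `σ`, with bottom endpoint at (new) position `b` and top
endpoint at (new) position `t`. -/
def insertAt {n : ℕ} (σ : Equiv.Perm (Fin (n + 1))) (b t : Fin (n + 2)) :
    Equiv.Perm (Fin (n + 2)) :=
  ((finSuccEquiv' b).trans (Equiv.optionCongr σ)).trans (finSuccEquiv' t).symm

/-- The face containing the top arc whose clockwise starting point is the top point `j`
(for `1 ≤ j` this is the top arc lying immediately to the left of top point `j`). -/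
def faceOfTopPoint {n : ℕ} (σ : Equiv.Perm (Fin n)) (j : Fin n) : Finset (Darts n) :=
  faceOf σ (chordInv σ (Sum.inr j))

/-- The face containing the bottom arc between bottom points `i` and `i + 1`. -/
def faceOfBotPoint {n : ℕ} (σ : Equiv.Perm (Fin n)) (i : Fin n) : Finset (Darts n) :=
  faceOf σ (chordInv σ (Sum.inl i))

/-- The top principal cycle: the face containing the top arc between top points 1 and 2. -/
def topPrincipalFace {n : ℕ} (σ : Equiv.Perm (Fin (n + 1))) : Finset (Darts (n + 1)) :=
  faceOfTopPoint σ 1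

/-- The bottom principal cycle: the face containing the bottom arc between bottom points
1 and 2. -/
def botPrincipalFace {n : ℕ} (σ : Equiv.Perm (Fin (n + 1))) : Finset (Darts (n + 1)) :=
  faceOfBotPoint σ 0

def topPrincipalLen {n : ℕ} (σ : Equiv.Perm (Fin (n + 1))) : ℕ :=
  faceLen σ (topPrincipalFace σ)

def botPrincipalLen {n : ℕ} (σ : Equiv.Perm (Fin (n + 1))) : ℕ :=
  faceLen σ (botPrincipalFace σ)

/-- The dart whose step traverses the top principal arc. -/
def topPrincipalDart {n : ℕ} (σ : Equiv.Perm (Fin (n + 1))) : Darts (n + 1) :=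
  chordInv σ (Sum.inr 1)

/-- The dart whose step traverses the bottom principal arc. -/
def botPrincipalDart {n : ℕ} (σ : Equiv.Perm (Fin (n + 1))) : Darts (n + 1) :=
  chordInv σ (Sum.inl 0)

open scoped Classical in
/-- When the top and bottom principal arcs lie on a common cycle, the number of top arcs on
the portion of that cycle going from the bottom principal arc to the top principal arc
(inclusive of the latter). -/
noncomputable def portionA {n : ℕ} (σ : Equiv.Perm (Fin (n + 1))) : ℕ :=
  if h : ∃ k, 0 < k ∧ ((facePerm σ) ^ k) (botPrincipalDart σ) = topPrincipalDart σ then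
    ((Finset.Icc 1 (Nat.find h)).filter fun e =>
      isTopStart σ (((facePerm σ) ^ e) (botPrincipalDart σ)) = true).card
  else 0

open scoped Classical in
/-- The number of top arcs on the other portion, from the top principal arc (inclusive)
to the bottom principal arc. -/
noncomputable def portionB {n : ℕ} (σ : Equiv.Perm (Fin (n + 1))) : ℕ :=
  if h : ∃ k, 0 < k ∧ ((facePerm σ) ^ k) (topPrincipalDart σ) = botPrincipalDart σ then
    ((Finset.range (Nat.find h)).filter fun e =>
      isTopStart σ (((facePerm σ) ^ e) (topPrincipalDart σ)) = true).card
  else 0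

/-- A standard permutation has type `X(r, i)` if its top and bottom principal cycles are
distinct, of lengths `r` and `i` respectively. -/
def TypeX {n : ℕ} (σ : Equiv.Perm (Fin (n + 1))) (r i : ℕ) : Prop :=
  topPrincipalFace σ ≠ botPrincipalFace σ ∧ topPrincipalLen σ = r ∧ botPrincipalLen σ = i

/-- A standard permutation has type `H(a, b)` if its top and bottom principal cycles
coincide, and the two portions into which the two principal arcs divide this common cycle
carry `a` resp. `b` top arcs. -/
def TypeH {n : ℕ} (σ : Equiv.Perm (Fin (n + 1))) (a b : ℕ) : Prop :=
  topPrincipalFace σ = botPrincipalFace σ ∧ portionA σ = a ∧ portionB σ = b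

instance {n : ℕ} (σ : Equiv.Perm (Fin (n + 1))) (r i : ℕ) : Decidable (TypeX σ r i) :=
  inferInstanceAs (Decidable
    (topPrincipalFace σ ≠ botPrincipalFace σ ∧ topPrincipalLen σ = r ∧ botPrincipalLen σ = i))

noncomputable instance {n : ℕ} (σ : Equiv.Perm (Fin (n + 1))) (a b : ℕ) : Decidable (TypeH σ a b) :=
  inferInstanceAs (Decidable
    (topPrincipalFace σ = botPrincipalFace σ ∧ portionA σ = a ∧ portionB σ = b))

/-- The step made from dart `p` traverses one of the two side arcs (the arc from `t_1` to
`b_1`, or the arc from `b_n` to `t_n`). -/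
def isSideStart {n : ℕ} (σ : Equiv.Perm (Fin (n + 1))) (p : Darts (n + 1)) : Prop :=
  chordInv σ p = Sum.inr 0 ∨ chordInv σ p = Sum.inl (Fin.last n)

/-- Given labelling data `f`, the dart of the arc carrying label `(m, k, j)`: for odd `j` the
top arc `t_{j,m,k}` whose clockwise starting top point is `f m k j`, for even `j` the bottom
arc `b_{j,m,k}` starting at bottom point `f m k j`. -/
def labDart {n : ℕ} (σ : Equiv.Perm (Fin (n + 1))) (f : ℕ → ℕ → ℕ → Fin (n + 1))
    (m k j : ℕ) : Darts (n + 1) :=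
  if j % 2 = 1 then chordInv σ (Sum.inr (f m k j)) else chordInv σ (Sum.inl (f m k j))

/-- `(m, k, j)` is a valid arc label: `m` occurs in `λ(σ)` with multiplicity at least `k ≥ 1`,
and `j < 2m`. -/
def ValidLabel {n : ℕ} (σ : Equiv.Perm (Fin (n + 1))) (m k j : ℕ) : Prop :=
  1 ≤ k ∧ k ≤ (cycleInv σ).count m ∧ j < 2 * m

/-- `f` is a consistent labelling of the arcs of `σ`: for each cycle of length `m`
(the `k`-th among those), its top arcs are labelled `t_{1,m,k}, t_{3,m,k}, …` and its bottom
arcs `b_{0,m,k}, b_{2,m,k}, …`, interleaved, following the cyclic order of the cycle. -/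
def IsConsistentLabelling {n : ℕ} (σ : Equiv.Perm (Fin (n + 1)))
    (f : ℕ → ℕ → ℕ → Fin (n + 1)) : Prop :=
  (∀ m k j, ValidLabel σ m k j → j % 2 = 1 → 1 ≤ (f m k j : ℕ)) ∧
  (∀ m k j, ValidLabel σ m k j → j % 2 = 0 → (f m k j : ℕ) < n) ∧
  (∀ m k j, ValidLabel σ m k j →
    faceOf σ (labDart σ f m k j) = faceOf σ (labDart σ f m k 0)) ∧
  (∀ m k j, ValidLabel σ m k j → faceLen σ (faceOf σ (labDart σ f m k j)) = m) ∧
  (∀ m k j m' k' j', ValidLabel σ m k j → ValidLabel σ m' k' j' →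
    labDart σ f m k j = labDart σ f m' k' j' → m = m' ∧ k = k' ∧ j = j') ∧
  (∀ m k m' k', ValidLabel σ m k 0 → ValidLabel σ m' k' 0 →
    faceOf σ (labDart σ f m k 0) = faceOf σ (labDart σ f m' k' 0) → m = m' ∧ k = k') ∧
  (∀ p : Darts (n + 1), ¬ isSideStart σ p → ∃ m k j, ValidLabel σ m k j ∧ labDart σ f m k j = p) ∧
  (∀ m k j, ValidLabel σ m k j → ∃ d, 0 < d ∧
    ((facePerm σ) ^ d) (labDart σ f m k j) = labDart σ f m k ((j + 1) % (2 * m)) ∧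
    ∀ e, 0 < e → e < d → isSideStart σ (((facePerm σ) ^ e) (labDart σ f m k j)))



/-! ### Explicit formulas -/

lemma topCycle_val {n : ℕ} (a : Fin (n + 1)) (ha : a.val < n) (v : Fin (n + 1)) :
    (topCycle a v).val = if v.val ≤ a.val then v.val else if v.val < n then v.val + 1
      else a.val + 1 := by
  have hne : a ≠ Fin.last n := by
    intro h; rw [h] at ha; simp at ha
  have h1 : (a + 1).val = a.val + 1 := by
    rw [Fin.val_add_one, if_neg hne]
  have hv := v.isLt
  have hL : (Fin.last n - (a + 1)).val = n - (a.val + 1) := by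
    rw [Fin.sub_val_of_le (by rw [Fin.le_def, h1]; simpa using ha), h1, Fin.val_last]
  have hT : topCycle a v = (a + 1) + Fin.cycleRange (Fin.last n - (a + 1)) (v - (a + 1)) := by
    simp [topCycle, hne, sub_eq_neg_add]
  rw [hT]
  have hS : (v - (a + 1)).val = if v.val ≤ a.val then v.val + n - a.val else v.val - (a.val + 1) := by
    split_ifs with h
    · rw [Fin.sub_def]
      simp only [h1]
      rw [Nat.mod_eq_of_lt] <;> omega
    · rw [Fin.sub_val_of_le (by rw [Fin.le_def, h1]; omega), h1]
  rcases lt_trichotomy (v - (a + 1)) (Fin.last n - (a + 1)) with h | h | h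
  · rw [Fin.cycleRange_of_lt h, Fin.val_add, h1]
    have h' := Fin.lt_def.1 h
    rw [hS, hL] at h'
    have : (v - (a + 1) + 1).val = (v - (a + 1)).val + 1 := by
      rw [Fin.val_add_one, if_neg]
      intro h2
      have := congrArg Fin.val h2
      rw [hS, Fin.val_last] at this
      split_ifs at this h' <;> omega
    rw [this, hS]
    split_ifs at h' ⊢ with h3 h4 <;> first | omega | (rw [Nat.mod_eq_of_lt] <;> omega)
  · rw [Fin.cycleRange_of_eq h]
    have h' := congrArg Fin.val h
    rw [hS, hL] at h'
    simp only [add_zero, h1]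
    split_ifs at h' ⊢ <;> omega
  · rw [Fin.cycleRange_of_gt h, add_sub_cancel]
    have h' := Fin.lt_def.1 h
    rw [hS, hL] at h'
    split_ifs at h' ⊢ <;> omega

lemma topCycle_last {n : ℕ} : topCycle (Fin.last n) = 1 := by simp [topCycle]

lemma circCode_inl {n : ℕ} (i : Fin n) : (circCode n (Sum.inl i)).val = i.val := by
  simp [circCode]

lemma circCode_inr {n : ℕ} (i : Fin n) : (circCode n (Sum.inr i)).val = n + (n - 1 - i.val) := by
  simp [circCode, Fin.val_rev]; omega

lemma nextPoint_eq_iff {n : ℕ} (p q : Darts (n + 1)) :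
    nextPoint (n + 1) p = q ↔ (circCode (n+1) q).val =
      if (circCode (n+1) p).val = n + 1 + n then 0 else (circCode (n+1) p).val + 1 := by
  have : nextPoint (n + 1) p = q ↔ circCode (n+1) q = finRotate (n + 1 + n + 1) (circCode (n+1) p) := by
    simp only [nextPoint, Equiv.trans_apply, Equiv.symm_apply_eq]
    exact eq_comm
  rw [this, Fin.ext_iff]
  have h2 : (finRotate (n + 1 + n + 1) (circCode (n+1) p)).val = 
      if (circCode (n+1) p).val = n + 1 + n then 0 else (circCode (n+1) p).val + 1 := by
    rw [coe_finRotate]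
    simp [Fin.ext_iff]
  rw [h2]

lemma nextPoint_inl_inl {n : ℕ} (i j : Fin (n + 1)) (h : j.val = i.val + 1) :
    nextPoint (n + 1) (Sum.inl i) = Sum.inl j := by
  rw [nextPoint_eq_iff, circCode_inl, circCode_inl]
  split_ifs <;> omega

lemma nextPoint_inl_last {n : ℕ} :
    nextPoint (n + 1) (Sum.inl (Fin.last n)) = Sum.inr (Fin.last n) := by
  rw [nextPoint_eq_iff, circCode_inl, circCode_inr]
  simp

lemma nextPoint_inr_inr {n : ℕ} (i j : Fin (n + 1)) (h : i.val = j.val + 1) :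
    nextPoint (n + 1) (Sum.inr i) = Sum.inr j := by
  rw [nextPoint_eq_iff, circCode_inr, circCode_inr]
  split_ifs <;> omega

lemma nextPoint_inr_zero {n : ℕ} :
    nextPoint (n + 1) (Sum.inr 0) = Sum.inl 0 := by
  rw [nextPoint_eq_iff, circCode_inl, circCode_inr]
  simp

lemma chordInv_inl {n : ℕ} (σ : Equiv.Perm (Fin n)) (i : Fin n) :
    chordInv σ (Sum.inl i) = Sum.inr (σ i) := rfl

lemma chordInv_inr {n : ℕ} (σ : Equiv.Perm (Fin n)) (i : Fin n) :
    chordInv σ (Sum.inr i) = Sum.inl (σ⁻¹ i) := rfl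

lemma facePerm_apply {n : ℕ} (σ : Equiv.Perm (Fin n)) (p : Darts n) :
    facePerm σ p = nextPoint n (chordInv σ p) := rfl

/-- every dart on the circle is of one of four kinds. -/
lemma darts_cases {n : ℕ} {P : Darts (n + 1) → Prop}
    (h1 : ∀ i j : Fin (n + 1), j.val = i.val + 1 → P (Sum.inl i))
    (h2 : P (Sum.inl (Fin.last n)))
    (h3 : ∀ i j : Fin (n + 1), i.val = j.val + 1 → P (Sum.inr i))
    (h4 : P (Sum.inr 0)) (u : Darts (n + 1)) : P u := by
  rcases u with i | i
  · by_cases h : i = Fin.last n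
    · rw [h]; exact h2
    · have := Fin.val_lt_last h
      exact h1 i ⟨i.val + 1, by omega⟩ rfl
  · by_cases h : i = 0
    · rw [h]; exact h4
    · have := Fin.pos_iff_ne_zero.2 h
      have h5 : 0 < i.val := this
      exact h3 i ⟨i.val - 1, by omega⟩ (by simp; omega)

lemma isTopStart_iff {n : ℕ} (σ : Equiv.Perm (Fin (n + 1))) (p : Darts (n + 1)) :
    isTopStart σ p = true ↔ p.isLeft = true ∧ ¬ (facePerm σ p).isLeft = true := by
  rw [facePerm_apply]
  rcases p with i | i
  · simp only [isTopStart, chordInv_inl]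
    by_cases h : σ i = 0
    · rw [h, nextPoint_inr_zero]; simp
    · have := Fin.pos_iff_ne_zero.2 h
      have h5 : 0 < (σ i).val := this
      rw [nextPoint_inr_inr (σ i) ⟨(σ i).val - 1, by omega⟩ (by simp; omega)]
      simp; omega
  · simp [isTopStart, chordInv_inr]

/-! ### Orbit invariants -/

section Orb
set_option linter.unusedSectionVars false
open Classical
variable {α β : Type*} [Fintype α] [Fintype β]

noncomputable def orb (f : Equiv.Perm α) (p : α) : Finset α := Finset.univ.filter (f.SameCycle p)

noncomputable def orbInv (f : Equiv.Perm α) (W : α → Prop) : Multiset ℕ :=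
  (Finset.univ.image (orb f)).val.map (fun F => (F.filter W).card)

lemma orb_eq_iff (f : Equiv.Perm α) (p q : α) : orb f p = orb f q ↔ f.SameCycle p q := by
  constructor
  · intro h
    have : q ∈ orb f q := by simp [orb, Equiv.Perm.SameCycle.refl]
    rw [← h] at this
    simpa [orb] using this
  · intro h
    ext x
    simp only [orb, Finset.mem_filter, Finset.mem_univ, true_and]
    exact ⟨fun h2 => h.symm.trans h2, fun h2 => h.trans h2⟩

lemma orbInv_compare (f : Equiv.Perm α) (g : Equiv.Perm β) (W : α → Prop) (V : β → Prop)
    (φ : α → β) (h1 : ∀ p q, f.SameCycle p q ↔ g.SameCycle (φ p) (φ q))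
    (h2 : ∀ b, ∃ p, g.SameCycle (φ p) b)
    (h3 : ∀ p, ((orb f p).filter W).card = ((orb g (φ p)).filter V).card) :
    orbInv f W = orbInv g V := by
  unfold orbInv
  have key : ∀ F ∈ Finset.univ.image (orb f), ∃ p, orb f p = F := by
    intro F hF; simpa using hF
  choose r hr using key
  refine Multiset.map_eq_map_of_bij_of_nodup _ _ (Finset.nodup _) (Finset.nodup _)
    (fun F hF => orb g (φ (r F hF))) ?_ ?_ ?_ ?_
  · intro F hF
    simp
  · intro F hF G hG h
    rw [orb_eq_iff, ← h1, ← orb_eq_iff, hr F hF, hr G hG] at h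
    exact h
  · intro G hG
    obtain ⟨b, rfl⟩ : ∃ b, orb g b = G := by simpa using hG
    obtain ⟨p, hp⟩ := h2 b
    have hm : orb f p ∈ Finset.univ.image (orb f) := by simp
    refine ⟨orb f p, hm, ?_⟩
    rw [orb_eq_iff]
    refine Equiv.Perm.SameCycle.trans ?_ hp
    rw [← h1, ← orb_eq_iff, hr _ hm]
  · intro F hF
    rw [← h3, hr F hF]

lemma sameCycle_induct (f : Equiv.Perm α) (R : α → α → Prop) (hR : Equivalence R)
    (h : ∀ p, R p (f p)) {p q : α} (hpq : f.SameCycle p q) : R p q := by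
  obtain ⟨k, -, -, rfl⟩ := hpq.exists_pow_eq f
  clear hpq
  induction k with
  | zero => exact hR.refl _
  | succ k ih => 
    rw [pow_succ']
    exact hR.trans ih (h _)

lemma sameCycle_apply (f : Equiv.Perm α) (p : α) : f.SameCycle p (f p) := ⟨1, by simp⟩

lemma sameCycle_equiv (f : Equiv.Perm α) : Equivalence f.SameCycle :=
  ⟨fun _ => Equiv.Perm.SameCycle.refl _ _, fun h => h.symm, fun h h' => h.trans h'⟩

lemma sameCycle_skip (f g : Equiv.Perm α) (z : α) (hf : f z ≠ z)
    (h : ∀ p, p ≠ z → (if f p = z then f z else f p) = (if g p = z then g z else g p))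
    {p q : α} (hp : p ≠ z) (hq : q ≠ z) (hpq : f.SameCycle p q) : g.SameCycle p q := by
  have := sameCycle_induct f
    (fun p q => g.SameCycle (if p = z then f z else p) (if q = z then f z else q))
    ⟨fun _ => (sameCycle_equiv g).refl _, fun h => (sameCycle_equiv g).symm h,
      fun h h' => (sameCycle_equiv g).trans h h'⟩ ?_ hpq
  · simpa [hp, hq] using this
  · intro p
    by_cases hpz : p = z
    · subst hpz
      simp [hf, Equiv.Perm.SameCycle.refl]
    · have h' := h p hpz
      simp only [if_neg hpz, h']
      split_ifs with h2
      · rw [← h2]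
        exact (sameCycle_apply g p).trans (sameCycle_apply g _)
      · exact sameCycle_apply g p

lemma orbInv_skip (f g : Equiv.Perm α) (W : α → Prop) (z : α) (hf : f z ≠ z) (hg : g z ≠ z)
    (hW : ¬ W z)
    (h : ∀ p, p ≠ z → (if f p = z then f z else f p) = (if g p = z then g z else g p)) :
    orbInv f W = orbInv g W := by
  have hsc : ∀ p q, p ≠ z → q ≠ z → (f.SameCycle p q ↔ g.SameCycle p q) := fun p q hp hq =>
    ⟨sameCycle_skip f g z hf h hp hq, sameCycle_skip g f z hg (fun p hp => (h p hp).symm) hp hq⟩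
  set φ : α → α := fun p => if p = z then f z else p with hφ
  have hφz : ∀ p, φ p ≠ z := by
    intro p; simp only [hφ]; split_ifs with h1
    · exact hf
    · exact h1
  have hφs : ∀ p, f.SameCycle p (φ p) := by
    intro p; simp only [hφ]; split_ifs with h1
    · rw [h1]; exact sameCycle_apply f z
    · exact Equiv.Perm.SameCycle.refl _ _
  refine orbInv_compare f g W W φ ?_ ?_ ?_
  · intro p q
    rw [← hsc _ _ (hφz p) (hφz q)]
    exact ⟨fun h => (hφs p).symm.trans (h.trans (hφs q)), fun h => (hφs p).trans (h.trans (hφs q).symm)⟩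
  · intro b
    by_cases hb : b = z
    · refine ⟨g z, ?_⟩
      simp only [hφ, if_neg hg, hb]
      exact (sameCycle_apply g z).symm
    · exact ⟨b, by simp only [hφ, if_neg hb]; exact Equiv.Perm.SameCycle.refl _ _⟩
  · intro p
    congr 1
    ext q
    simp only [orb, Finset.mem_filter, Finset.mem_univ, true_and]
    refine and_congr_left fun hq => ?_
    have hqz : q ≠ z := fun h => hW (h ▸ hq)
    rw [← hsc _ _ (hφz p) hqz]
    exact ⟨fun h => (hφs p).symm.trans h, fun h => (hφs p).trans h⟩

/-- the number of exits from `B` along an orbit equals the number of entries. -/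
lemma exits_eq_entries (f : Equiv.Perm α) (B : α → Prop) (p : α) :
    ((orb f p).filter (fun q => B q ∧ ¬ B (f q))).card =
    ((orb f p).filter (fun q => ¬ B q ∧ B (f q))).card := by
  have e1 : ((orb f p).filter (fun q => B (f q))).card = ((orb f p).filter B).card := by
    refine Finset.card_bij (fun q _ => f q) ?_ ?_ ?_
    · intro q hq
      simp only [orb, Finset.mem_filter, Finset.mem_univ, true_and] at hq ⊢
      exact ⟨hq.1.trans (sameCycle_apply f q), hq.2⟩
    · intro q _ q' _ h; exact f.injective h
    · intro q hq
      simp only [orb, Finset.mem_filter, Finset.mem_univ, true_and] at hq ⊢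
      refine ⟨f.symm q, ⟨hq.1.trans ?_, by simpa using hq.2⟩, by simp⟩
      have := sameCycle_apply f (f.symm q)
      rw [Equiv.apply_symm_apply] at this
      exact this.symm
  have e2 := Finset.card_filter_add_card_filter_not (s := (orb f p).filter B) (fun q => B (f q))
  have e3 := Finset.card_filter_add_card_filter_not (s := (orb f p).filter (fun q => B (f q))) B
  rw [Finset.filter_filter, Finset.filter_filter] at e2 e3
  have e4 : (orb f p).filter (fun q => B (f q) ∧ B q) = (orb f p).filter (fun q => B q ∧ B (f q)) := by
    congr 1; ext q; exact and_comm
  have e5 : (orb f p).filter (fun q => B (f q) ∧ ¬ B q) = (orb f p).filter (fun q => ¬ B q ∧ B (f q)) := by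
    congr 1; ext q; exact and_comm
  rw [e4, e5] at e3
  omega

lemma exits_eq_entries' (f : Equiv.Perm α) (B : α → Prop) (p : α) :
    ((orb f p).filter (fun q => B q ∧ ¬ B (f q))).card =
    ((orb f p).filter (fun q => B q ∧ ¬ B (f⁻¹ q))).card := by
  rw [exits_eq_entries]
  refine Finset.card_bij (fun q _ => f q) ?_ ?_ ?_
  · intro q hq
    simp only [orb, Finset.mem_filter, Finset.mem_univ, true_and] at hq ⊢
    exact ⟨hq.1.trans (sameCycle_apply f q), hq.2.2, by simpa using hq.2.1⟩
  · intro q _ q' _ h; exact f.injective h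
  · intro q hq
    simp only [orb, Finset.mem_filter, Finset.mem_univ, true_and] at hq ⊢
    refine ⟨f⁻¹ q, ⟨hq.1.trans ?_, hq.2.2, by simpa using hq.2.1⟩, by simp⟩
    have := sameCycle_apply f (f⁻¹ q)
    rw [show f (f⁻¹ q) = q by simp] at this
    exact this.symm

lemma sameCycle_conj (f : Equiv.Perm α) (g : Equiv.Perm β) (φ : α ≃ β)
    (h : ∀ p, φ (f p) = g (φ p)) (p q : α) : f.SameCycle p q ↔ g.SameCycle (φ p) (φ q) := by
  constructor
  · exact sameCycle_induct f (fun p q => g.SameCycle (φ p) (φ q))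
      ⟨fun _ => (sameCycle_equiv g).refl _, fun h => (sameCycle_equiv g).symm h,
      fun h h' => (sameCycle_equiv g).trans h h'⟩ (fun p => by rw [h]; exact sameCycle_apply g _)
  · intro hh
    have := sameCycle_induct g (fun p q => f.SameCycle (φ.symm p) (φ.symm q))
      ⟨fun _ => (sameCycle_equiv f).refl _, fun h => (sameCycle_equiv f).symm h,
      fun h h' => (sameCycle_equiv f).trans h h'⟩ ?_ hh
    · simpa using this
    · intro p
      have h' := h (φ.symm p)
      rw [Equiv.apply_symm_apply] at h'
      rw [← h', Equiv.symm_apply_apply]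
      exact sameCycle_apply f _

lemma orbInv_conj (f : Equiv.Perm α) (g : Equiv.Perm β) (W : α → Prop) (V : β → Prop)
    (φ : α ≃ β) (h : ∀ p, φ (f p) = g (φ p))
    (hW : ∀ p, ((orb f p).filter W).card = ((orb f p).filter (fun q => V (φ q))).card) :
    orbInv f W = orbInv g V := by
  refine orbInv_compare f g W V φ (sameCycle_conj f g φ h)
    (fun b => ⟨φ.symm b, by simp [Equiv.Perm.SameCycle.refl]⟩) ?_
  intro p
  rw [hW]
  refine Finset.card_bij (fun q _ => φ q) ?_ ?_ ?_
  · intro q hq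
    simp only [orb, Finset.mem_filter, Finset.mem_univ, true_and] at hq ⊢
    exact ⟨(sameCycle_conj f g φ h _ _).1 hq.1, hq.2⟩
  · intro q _ q' _ h; exact φ.injective h
  · intro q hq
    simp only [orb, Finset.mem_filter, Finset.mem_univ, true_and] at hq ⊢
    refine ⟨φ.symm q, ⟨?_, by simpa using hq.2⟩, by simp⟩
    rw [sameCycle_conj f g φ h]
    simpa using hq.1

lemma orb_inv (f : Equiv.Perm α) (p : α) : orb f⁻¹ p = orb f p := by
  ext q; simp [orb, Equiv.Perm.sameCycle_inv]

lemma orbInv_inv (f : Equiv.Perm α) (W : α → Prop) : orbInv f⁻¹ W = orbInv f W := by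
  unfold orbInv
  rw [show orb f⁻¹ = orb f from funext (orb_inv f)]

end Orb

lemma faceOf_eq {n : ℕ} (σ : Equiv.Perm (Fin n)) (p : Darts n) : faceOf σ p = orb (facePerm σ) p := by
  classical
  ext q
  simp only [faceOf, orb, Finset.mem_filter, Finset.mem_univ, true_and]
  constructor
  · rintro ⟨k, hk⟩
    exact ⟨(k : ℕ), by simpa using hk⟩
  · intro h
    have hpos : 0 < n + n := by rcases p with i | i <;> have := i.isLt <;> omega
    by_cases hpq : p = q
    · exact ⟨⟨0, hpos⟩, by simpa using hpq⟩
    · have hs : p ∈ (facePerm σ).support := by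
        rw [Equiv.Perm.mem_support]
        intro hfix
        exact hpq (Equiv.Perm.SameCycle.eq_of_left h hfix)
      obtain ⟨k, hk, hk2⟩ := h.exists_pow_eq_of_mem_support hs
      refine ⟨⟨k, hk.trans_le ?_⟩, hk2⟩
      refine (Finset.card_le_univ _).trans ?_
      simp

lemma cycleInv_eq {n : ℕ} (σ : Equiv.Perm (Fin (n + 1))) :
    cycleInv σ = orbInv (facePerm σ)
      (fun p => p.isLeft = true ∧ ¬ (facePerm σ p).isLeft = true) := by
  classical
  unfold cycleInv orbInv
  have h1 : (fun p => faceOf σ p) = orb (facePerm σ) := funext (faceOf_eq σ)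
  rw [h1]
  have h2 : faceLen σ = fun F => (F.filter
      (fun p => p.isLeft = true ∧ ¬ (facePerm σ p).isLeft = true)).card := by
    funext F
    unfold faceLen
    simp only [isTopStart_iff]
  rw [h2]
  congr!

/-! ### Symmetries of the cycle invariant -/

lemma cycleInv_inv {n : ℕ} (σ : Equiv.Perm (Fin (n + 1))) : cycleInv σ⁻¹ = cycleInv σ := by
  symm
  have hnext : ∀ u : Darts (n + 1),
      nextPoint (n + 1) (Sum.swap (nextPoint (n + 1) u)) = Sum.swap u := by
    apply darts_cases
    · intro i j h
      rw [nextPoint_inl_inl i j h, Sum.swap_inl, nextPoint_inr_inr j i h, Sum.swap_inl]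
    · rw [nextPoint_inl_last, Sum.swap_inr, nextPoint_inl_last, Sum.swap_inl]
    · intro i j h
      rw [nextPoint_inr_inr i j h, Sum.swap_inr, nextPoint_inl_inl j i h, Sum.swap_inr]
    · rw [nextPoint_inr_zero, Sum.swap_inl, nextPoint_inr_zero, Sum.swap_inr]
  let Φ : Darts (n + 1) ≃ Darts (n + 1) := Equiv.sumCongr σ σ⁻¹
  have hΦ : ∀ p, facePerm σ⁻¹ (Φ (facePerm σ p)) = Φ p := by
    intro p
    have h1 : ∀ u, chordInv σ⁻¹ (Φ u) = Sum.swap u := by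
      rintro (i | i)
      · simp [Φ, chordInv_inl]
      · simp [Φ, chordInv_inr]
    rw [facePerm_apply, h1, facePerm_apply, hnext]
    rcases p with i | i <;> rfl
  have hconj : ∀ p, Φ ((facePerm σ)⁻¹ p) = facePerm σ⁻¹ (Φ p) := by
    intro p
    rw [← hΦ]; simp
  have hl : ∀ p, (Φ p).isLeft = p.isLeft := by rintro (i | i) <;> rfl
  rw [cycleInv_eq, cycleInv_eq, ← orbInv_inv]
  refine orbInv_conj _ _ _ _ Φ hconj ?_
  intro p
  simp only [← hconj, hl, orb_inv]
  convert exits_eq_entries' (facePerm σ) (fun q => q.isLeft = true) p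

lemma rotD_apply {n : ℕ} (σ : Equiv.Perm (Fin n)) (i : Fin n) :
    rotD σ i = (σ⁻¹ i.rev).rev := rfl

lemma rotD_rotD {n : ℕ} (σ : Equiv.Perm (Fin n)) : rotD (rotD σ) = σ := by
  ext i
  simp [rotD, mul_inv_rev, mul_assoc]

lemma rotD_inv_apply {n : ℕ} (σ : Equiv.Perm (Fin n)) (i : Fin n) :
    (rotD σ)⁻¹ i = (σ i.rev).rev := by
  rw [Equiv.Perm.inv_eq_iff_eq, rotD_apply]
  simp

lemma cycleInv_rotD {n : ℕ} (σ : Equiv.Perm (Fin (n + 1))) : cycleInv (rotD σ) = cycleInv σ := by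
  symm
  let Φ : Darts (n + 1) ≃ Darts (n + 1) :=
    (Equiv.sumCongr Fin.revPerm Fin.revPerm).trans (Equiv.sumComm _ _)
  have hl : ∀ i, Φ (Sum.inl i) = Sum.inr i.rev := fun _ => rfl
  have hr : ∀ i, Φ (Sum.inr i) = Sum.inl i.rev := fun _ => rfl
  have hnext : ∀ u : Darts (n + 1), Φ (nextPoint (n + 1) u) = nextPoint (n + 1) (Φ u) := by
    apply darts_cases
    · intro i j h
      rw [nextPoint_inl_inl i j h, hl, hl, nextPoint_inr_inr _ j.rev]
      simp only [Fin.val_rev]; omega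
    · rw [nextPoint_inl_last, hl, hr, Fin.rev_last, nextPoint_inr_zero]
    · intro i j h
      rw [nextPoint_inr_inr i j h, hr, hr, nextPoint_inl_inl _ j.rev]
      simp only [Fin.val_rev]; omega
    · rw [nextPoint_inr_zero, hr, hl, Fin.rev_zero, nextPoint_inl_last]
  have hchord : ∀ u, Φ (chordInv σ u) = chordInv (rotD σ) (Φ u) := by
    rintro (i | i)
    · rw [chordInv_inl, hr, hl, chordInv_inr, rotD_inv_apply, Fin.rev_rev]
    · rw [chordInv_inr, hl, hr, chordInv_inl, rotD_apply, Fin.rev_rev]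
  have hconj : ∀ p, Φ (facePerm σ p) = facePerm (rotD σ) (Φ p) := by
    intro p
    rw [facePerm_apply, hnext, hchord, facePerm_apply]
  have hs : ∀ p, (Φ p).isLeft = true ↔ ¬ p.isLeft = true := by rintro (i | i) <;> simp [hl, hr]
  rw [cycleInv_eq, cycleInv_eq]
  refine orbInv_conj _ _ _ _ Φ hconj ?_
  intro p
  simp only [← hconj, hs, not_not]
  convert exits_eq_entries (facePerm σ) (fun q => q.isLeft = true) p

/-! ### The move `L` and the cycle invariant -/

lemma topCycle_eq_one {n : ℕ} (a : Fin (n + 1)) (h : n ≤ a.val + 1) : topCycle a = 1 := by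
  by_cases ha : a = Fin.last n
  · rw [ha, topCycle_last]
  · have h1 := Fin.val_lt_last ha
    ext v
    rw [topCycle_val a h1]
    have := v.isLt
    simp only [Equiv.Perm.coe_one, id_eq]
    split_ifs <;> omega

lemma cycleInv_moveL {n : ℕ} (σ : Equiv.Perm (Fin (n + 1))) : cycleInv (moveL σ) = cycleInv σ := by
  symm
  change _ = cycleInv (topCycle (σ (Fin.last n)) * σ)
  obtain ⟨a, ha⟩ : ∃ a, a = σ (Fin.last n) := ⟨_, rfl⟩
  rw [← ha]
  by_cases hle : n ≤ a.val + 1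
  · rw [topCycle_eq_one a hle, one_mul]
  have han : a.val + 1 < n := by omega
  have hc := topCycle_val a (by omega)
  generalize topCycle a = c at hc
  let C : Equiv.Perm (Darts (n + 1)) := Equiv.sumCongr (Equiv.refl _) c
  have hCl : ∀ i, C (Sum.inl i) = Sum.inl i := fun _ => rfl
  have hCr : ∀ i, C (Sum.inr i) = Sum.inr (c i) := fun _ => rfl
  have hCs : ∀ p, (C p).isLeft = p.isLeft := by rintro (i | i) <;> rfl
  have hchord : ∀ u, C (chordInv σ u) = chordInv (c * σ) (C u) := by
    rintro (i | i)
    · simp [chordInv_inl, hCl, hCr]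
    · simp [chordInv_inr, hCl, hCr, mul_inv_rev]
  let m : Equiv.Perm (Darts (n + 1)) := C⁻¹ * nextPoint (n + 1) * C
  have hm : ∀ u w, m u = w ↔ nextPoint (n + 1) (C u) = C w := by
    intro u w
    simp only [m, Equiv.Perm.mul_apply]
    rw [Equiv.Perm.inv_eq_iff_eq]
  let g : Equiv.Perm (Darts (n + 1)) := m * chordInv σ
  have hg : ∀ p, g p = m (chordInv σ p) := fun _ => rfl
  have hconj : ∀ p, C (g p) = facePerm (c * σ) (C p) := by
    intro p
    rw [hg, facePerm_apply, ← hchord, ← (hm _ _).1 rfl]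
  have hcz : c 0 = 0 := by
    ext; rw [hc]; simp
  -- the explicit values of `m`
  have m1 : ∀ i j : Fin (n + 1), j.val = i.val + 1 → m (Sum.inl i) = Sum.inl j := by
    intro i j h
    rw [hm, hCl, hCl, nextPoint_inl_inl i j h]
  have m2 : m (Sum.inl (Fin.last n)) = Sum.inr ⟨n - 1, by omega⟩ := by
    rw [hm, hCl, hCr, nextPoint_inl_last]
    congr 1
    ext
    rw [hc]
    simp only [Fin.val_last]
    split_ifs <;> omega
  have m3 : m (Sum.inr 0) = Sum.inl 0 := by
    rw [hm, hCl, hCr, hcz, nextPoint_inr_zero]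
  have m4 : ∀ i j : Fin (n + 1), i.val = j.val + 1 → i.val ≠ a.val + 1 → i.val < n →
      m (Sum.inr i) = Sum.inr j := by
    intro i j h h1 h2
    rw [hm, hCr, hCr]
    apply nextPoint_inr_inr
    rw [hc, hc]
    split_ifs <;> omega
  have m5 : ∀ i : Fin (n + 1), i.val = a.val + 1 → m (Sum.inr i) = Sum.inr (Fin.last n) := by
    intro i h
    rw [hm, hCr, hCr]
    apply nextPoint_inr_inr
    rw [hc, hc]
    simp only [Fin.val_last]
    split_ifs <;> omega
  have m6 : m (Sum.inr (Fin.last n)) = Sum.inr a := by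
    rw [hm, hCr, hCr]
    apply nextPoint_inr_inr
    rw [hc, hc]
    simp only [Fin.val_last]
    split_ifs <;> omega
  have cz : chordInv σ (Sum.inr a) = Sum.inl (Fin.last n) := by
    rw [chordInv_inr, ha]; simp
  have fz : facePerm σ (Sum.inr a) = Sum.inr (Fin.last n) := by
    rw [facePerm_apply, cz, nextPoint_inl_last]
  have gz : g (Sum.inr a) = Sum.inr ⟨n - 1, by omega⟩ := by
    rw [hg, cz, m2]
  have skip : ∀ p, p ≠ Sum.inr a →
      (if facePerm σ p = Sum.inr a then facePerm σ (Sum.inr a) else facePerm σ p) =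
      (if g p = Sum.inr a then g (Sum.inr a) else g p) := by
    intro p hp
    rw [fz, gz, hg, facePerm_apply]
    have hu : chordInv σ p ≠ Sum.inl (Fin.last n) := by
      rw [← cz]; exact fun h => hp ((chordInv σ).injective h)
    generalize chordInv σ p = u at hu
    revert u
    apply darts_cases
    · intro i j h _
      rw [m1 i j h, nextPoint_inl_inl i j h]
      simp
    · intro h; exact absurd rfl h
    · intro i j h _
      rw [nextPoint_inr_inr i j h]
      by_cases h1 : i.val = a.val + 1
      · have : j = a := by ext; omega
        rw [m5 i h1, this, if_pos rfl, if_neg]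
        intro h2
        have := congrArg Fin.val (Sum.inr.inj h2)
        simp at this; omega
      · have hja : ¬ (Sum.inr j : Darts (n + 1)) = Sum.inr a := by
          intro h2
          have := congrArg Fin.val (Sum.inr.inj h2)
          omega
        rw [if_neg hja]
        by_cases h2 : i.val < n
        · rw [m4 i j h h1 h2, if_neg hja]
        · have : i = Fin.last n := by ext; simp; omega
          rw [this, m6, if_pos rfl]
          congr 1
          ext
          simp; omega
    · intro _
      rw [m3, nextPoint_inr_zero]
      simp
  have hfz : facePerm σ (Sum.inr a) ≠ Sum.inr a := by
    rw [fz]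
    intro h2
    have := congrArg Fin.val (Sum.inr.inj h2)
    simp at this; omega
  have hgz : g (Sum.inr a) ≠ Sum.inr a := by
    rw [gz]
    intro h2
    have := congrArg Fin.val (Sum.inr.inj h2)
    simp at this; omega
  rw [cycleInv_eq, cycleInv_eq, orbInv_skip _ g _ (Sum.inr a) hfz hgz (by simp)
    (fun p hp => by convert skip p hp)]
  refine orbInv_conj _ _ _ _ C hconj ?_
  intro p
  simp only [← hconj, hCs]
  congr 2
  funext q
  congr 2
  rcases q with i | i
  · rw [hg, facePerm_apply, chordInv_inl]
    refine darts_cases (P := fun u => ((nextPoint (n + 1) u).isLeft = true) = ((m u).isLeft = true))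
      ?_ ?_ ?_ ?_ (Sum.inr (σ i))
    · intro i j h
      rw [m1 i j h, nextPoint_inl_inl i j h]
    · rw [m2, nextPoint_inl_last]; simp
    · intro i j h
      rw [nextPoint_inr_inr i j h]
      by_cases h1 : i.val = a.val + 1
      · rw [m5 i h1]; simp
      · by_cases h2 : i.val < n
        · rw [m4 i j h h1 h2]
        · have : i = Fin.last n := by ext; simp; omega
          rw [this, m6]; simp
    · rw [m3, nextPoint_inr_zero]
  · rw [hg, facePerm_apply, chordInv_inr]
    refine darts_cases (P := fun u => ((nextPoint (n + 1) u).isLeft = true) = ((m u).isLeft = true))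
      ?_ ?_ ?_ ?_ (Sum.inl (σ⁻¹ i))
    · intro i j h
      rw [m1 i j h, nextPoint_inl_inl i j h]
    · rw [m2, nextPoint_inl_last]; simp
    · intro i j h
      rw [nextPoint_inr_inr i j h]
      by_cases h1 : i.val = a.val + 1
      · rw [m5 i h1]; simp
      · by_cases h2 : i.val < n
        · rw [m4 i j h h1 h2]
        · have : i = Fin.last n := by ext; simp; omega
          rw [this, m6]; simp
    · rw [m3, nextPoint_inr_zero]

/-! ### The sign invariant -/

/-- the edges `i` and `j` cross. -/
def Cross {n : ℕ} (σ : Equiv.Perm (Fin n)) (i j : Fin n) : Prop :=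
  (i < j ∧ σ j < σ i) ∨ (j < i ∧ σ i < σ j)

instance {n : ℕ} (σ : Equiv.Perm (Fin n)) (i j : Fin n) : Decidable (Cross σ i j) :=
  inferInstanceAs (Decidable (_ ∨ _))

/-- the summand of the sign sum. -/
def term {n : ℕ} (σ : Equiv.Perm (Fin n)) (S : Finset (Fin n)) : ℤ :=
  (-1 : ℤ) ^ (S.card + inversions σ S)

lemma inversions_insert {n : ℕ} (σ : Equiv.Perm (Fin n)) (x : Fin n) (S : Finset (Fin n))
    (hx : x ∉ S) :
    inversions σ (insert x S) = inversions σ S + (S.filter (Cross σ x)).card := by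
  classical
  unfold inversions
  have e : ((insert x S) ×ˢ (insert x S)).filter (fun p => p.1 < p.2 ∧ σ p.2 < σ p.1) =
      ((S ×ˢ S).filter fun p => p.1 < p.2 ∧ σ p.2 < σ p.1) ∪
      (S.filter (Cross σ x)).image (fun j => if x < j then (x, j) else (j, x)) := by
    ext ⟨i, j⟩
    simp only [Finset.mem_filter, Finset.mem_product, Finset.mem_insert, Finset.mem_union,
      Finset.mem_image, Cross]
    constructor
    · rintro ⟨⟨rfl | hi, rfl | hj⟩, h1, h2⟩
      · exact absurd h1 (lt_irrefl _)
      · right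
        exact ⟨j, ⟨hj, Or.inl ⟨h1, h2⟩⟩, by rw [if_pos h1]⟩
      · right
        exact ⟨i, ⟨hi, Or.inr ⟨h1, h2⟩⟩, by rw [if_neg (not_lt.2 h1.le)]⟩
      · left; exact ⟨⟨hi, hj⟩, h1, h2⟩
    · rintro (⟨⟨hi, hj⟩, h1, h2⟩ | ⟨k, ⟨hk, h⟩, h3⟩)
      · exact ⟨⟨Or.inr hi, Or.inr hj⟩, h1, h2⟩
      · rcases h with ⟨h1, h2⟩ | ⟨h1, h2⟩
        · rw [if_pos h1] at h3
          obtain ⟨rfl, rfl⟩ := Prod.mk.inj h3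
          exact ⟨⟨Or.inl rfl, Or.inr hk⟩, h1, h2⟩
        · rw [if_neg (not_lt.2 h1.le)] at h3
          obtain ⟨rfl, rfl⟩ := Prod.mk.inj h3
          exact ⟨⟨Or.inr hk, Or.inl rfl⟩, h1, h2⟩
  rw [e, Finset.card_union_of_disjoint, Finset.card_image_of_injOn]
  · intro i hi j hj hij
    have hi' : i ≠ x := by rintro rfl; exact hx (Finset.mem_filter.1 hi).1
    have hj' : j ≠ x := by rintro rfl; exact hx (Finset.mem_filter.1 hj).1
    simp only at hij
    split_ifs at hij <;> simp_all
  · rw [Finset.disjoint_left]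
    rintro ⟨i, j⟩ h1 h2
    simp only [Finset.mem_filter, Finset.mem_product, Finset.mem_image] at h1 h2
    obtain ⟨k, -, hk⟩ := h2
    split_ifs at hk <;> (obtain ⟨rfl, rfl⟩ := Prod.mk.inj hk; exact hx (by tauto))

lemma term_insert {n : ℕ} (σ : Equiv.Perm (Fin n)) (x : Fin n) (S : Finset (Fin n))
    (hx : x ∉ S) :
    term σ (insert x S) = - (-1) ^ (S.filter (Cross σ x)).card * term σ S := by
  unfold term
  rw [inversions_insert σ x S hx, Finset.card_insert_of_notMem hx]
  ring

lemma inversions_map {n : ℕ} (σ τ ρ : Equiv.Perm (Fin n)) (S : Finset (Fin n))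
    (h : ∀ i j, Cross σ i j ↔ Cross τ (ρ i) (ρ j)) :
    inversions τ (S.map ρ.toEmbedding) = inversions σ S := by
  induction S using Finset.induction_on with
  | empty => simp [inversions]
  | insert x S hx ih =>
    rw [Finset.map_insert, inversions_insert _ _ _ (by simpa using hx), inversions_insert _ _ _ hx, ih]
    congr 1
    rw [Finset.filter_map, Finset.card_map]
    congr 1
    ext j
    simp [h]

lemma signSum_conj {n : ℕ} (σ τ ρ : Equiv.Perm (Fin n))
    (h : ∀ i j, Cross σ i j ↔ Cross τ (ρ i) (ρ j)) : signSum σ = signSum τ := by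
  unfold signSum
  refine Fintype.sum_equiv (Equiv.finsetCongr ρ) _ _ ?_
  intro S
  rw [Equiv.finsetCongr_apply, inversions_map σ τ ρ S h, Finset.card_map]

lemma signSum_inv {n : ℕ} (σ : Equiv.Perm (Fin n)) : signSum σ⁻¹ = signSum σ := by
  symm
  apply signSum_conj σ σ⁻¹ σ
  intro i j
  have hs : ∀ k, σ⁻¹ (σ k) = k := by simp
  simp only [Cross, hs]
  tauto

lemma signSum_rotD {n : ℕ} (σ : Equiv.Perm (Fin n)) : signSum (rotD σ) = signSum σ := by
  symm
  apply signSum_conj σ (rotD σ) (Fin.revPerm * σ)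
  intro i j
  have hs : ∀ k, σ⁻¹ (σ k) = k := by simp
  simp only [Cross, Equiv.Perm.mul_apply, Fin.revPerm_apply, rotD_apply, Fin.rev_rev,
    hs, Fin.rev_lt_rev]
  tauto

lemma term_congr {n : ℕ} (σ τ : Equiv.Perm (Fin n)) (S : Finset (Fin n))
    (h : ∀ i ∈ S, ∀ j ∈ S, σ i < σ j ↔ τ i < τ j) : term τ S = term σ S := by
  unfold term inversions
  congr 3
  ext ⟨i, j⟩
  simp only [Finset.mem_filter, Finset.mem_product]
  constructor
  · rintro ⟨⟨hi, hj⟩, h1, h2⟩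
    exact ⟨⟨hi, hj⟩, h1, (h _ hj _ hi).2 h2⟩
  · rintro ⟨⟨hi, hj⟩, h1, h2⟩
    exact ⟨⟨hi, hj⟩, h1, (h _ hj _ hi).1 h2⟩

lemma signSum_moveL {n : ℕ} (σ : Equiv.Perm (Fin (n + 1))) : signSum (moveL σ) = signSum σ := by
  classical
  change signSum (topCycle (σ (Fin.last n)) * σ) = _
  obtain ⟨a, ha⟩ : ∃ a, a = σ (Fin.last n) := ⟨_, rfl⟩
  rw [← ha]
  by_cases hle : n ≤ a.val + 1
  · rw [topCycle_eq_one a hle, one_mul]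
  have han : a.val + 1 < n := by omega
  have hc := topCycle_val a (by omega)
  generalize topCycle a = c at hc
  obtain ⟨e, he⟩ : ∃ e, e = Fin.last n := ⟨_, rfl⟩
  rw [← he] at ha
  obtain ⟨m, hm⟩ : ∃ m, σ m = Fin.last n := σ.surjective _
  have hmv : (σ m).val = n := by rw [hm]; simp
  have hme : m ≠ e := by
    rintro rfl
    rw [← ha] at hmv; omega
  have hlt : ∀ j, j ≠ m → (σ j).val < n := by
    intro j hj
    have h1 : σ j ≠ Fin.last n := by rw [← hm]; exact fun h => hj (σ.injective h)
    simpa using Fin.val_lt_last h1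
  -- value comparison off `m`
  have hoff : ∀ S : Finset (Fin (n + 1)), m ∉ S → term (c * σ) S = term σ S := by
    intro S hS
    apply term_congr
    intro i hi j hj
    have h1 := hlt i (by rintro rfl; exact hS hi)
    have h2 := hlt j (by rintro rfl; exact hS hj)
    simp only [Equiv.Perm.mul_apply, Fin.lt_def, hc]
    split_ifs <;> omega
  have hinsE : ∀ S : Finset (Fin (n + 1)), e ∉ S →
      term σ (insert e S) = - (-1) ^ (S.filter (fun j => a < σ j)).card * term σ S := by
    intro S hS
    rw [term_insert σ e S hS]
    congr 4
    apply Finset.filter_congr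
    intro j hj
    have hje : j ≠ e := by rintro rfl; exact hS hj
    have : j < e := by rw [he] at hje ⊢; exact Fin.lt_last_iff_ne_last.2 hje
    simp only [Cross, ← ha, this, not_lt.2 this.le, true_and, false_and, false_or]
  have hflip : ∀ T : Finset (Fin (n + 1)), m ∉ T →
      term (c * σ) (insert m T) =
        (-1) ^ (T.filter (fun j => a < σ j)).card * term σ (insert m T) := by
    intro T hT
    rw [term_insert _ m T hT, term_insert _ m T hT, hoff T hT]
    have key : ((-1 : ℤ)) ^ (T.filter (Cross (c * σ) m)).card =
        (-1) ^ (T.filter (fun j => a < σ j)).card * (-1) ^ (T.filter (Cross σ m)).card := by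
      rw [← Finset.prod_const, ← Finset.prod_const, ← Finset.prod_const, Finset.prod_filter,
        Finset.prod_filter, Finset.prod_filter, ← Finset.prod_mul_distrib]
      apply Finset.prod_congr rfl
      intro j hj
      have hjm : j ≠ m := by rintro rfl; exact hT hj
      have h1 := hlt j hjm
      have hjm' : j.val ≠ m.val := fun h => hjm (Fin.ext h)
      have d1 : Cross (c * σ) m j ↔ (m.val < j.val ∧ σ j ≤ a) ∨ (j.val < m.val ∧ a < σ j) := by
        simp only [Cross, Equiv.Perm.mul_apply, Fin.lt_def, Fin.le_def, hc, hmv]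
        split_ifs <;> omega
      have d2 : Cross σ m j ↔ m.val < j.val := by
        simp only [Cross, Fin.lt_def, hmv]
        omega
      simp only [d1, d2, Fin.lt_def, Fin.le_def]
      split_ifs <;> omega
    rw [key]; ring
  have hcount : ∀ T : Finset (Fin (n + 1)), m ∉ T →
      ((insert m T).filter (fun j => a < σ j)).card = (T.filter (fun j => a < σ j)).card + 1 := by
    intro T hT
    rw [Finset.filter_insert, if_pos (by rw [Fin.lt_def]; omega), Finset.card_insert_of_notMem]
    simp [hT]
  have sq : ∀ k : ℕ, ((-1 : ℤ)) ^ k * (-1) ^ k = 1 := by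
    intro k; rw [← mul_pow]; norm_num
  -- the involution on subsets
  let inv : Finset (Fin (n + 1)) → Finset (Fin (n + 1)) := fun S =>
    if m ∈ S then (if e ∈ S then S.erase e else insert e S) else S
  have hinv : Function.Involutive inv := by
    intro S
    by_cases h1 : m ∈ S
    · by_cases h2 : e ∈ S
      · simp [inv, h1, h2, hme]
      · simp [inv, h1, h2]
    · simp [inv, h1]
  change ∑ S, term (c * σ) S = ∑ S, term σ S
  refine Fintype.sum_equiv hinv.toPerm _ _ ?_
  intro S
  change _ = term σ (inv S)
  by_cases h1 : m ∈ S
  · obtain ⟨T, hT, rfl⟩ : ∃ T, m ∉ T ∧ S = insert m T :=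
      ⟨S.erase m, by simp, by simp [h1]⟩
    rw [hflip T hT]
    by_cases h2 : e ∈ insert m T
    · have h3 : inv (insert m T) = (insert m T).erase e := by simp only [inv, if_pos h1, if_pos h2]
      rw [h3]
      have h4 := hinsE ((insert m T).erase e) (by simp)
      rw [Finset.insert_erase h2] at h4
      have h5 : ((insert m T).erase e).filter (fun j => a < σ j) =
          (insert m T).filter (fun j => a < σ j) := by
        ext j
        simp only [Finset.mem_filter, Finset.mem_erase]
        constructor
        · rintro ⟨⟨_, h⟩, h'⟩; exact ⟨h, h'⟩
        · rintro ⟨h, h'⟩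
          refine ⟨⟨?_, h⟩, h'⟩
          rintro rfl
          rw [← ha] at h'
          exact lt_irrefl _ h'
      rw [h5, hcount T hT] at h4
      rw [h4, pow_succ]
      linear_combination (term σ ((insert m T).erase e)) * sq (T.filter (fun j => a < σ j)).card
    · have h3 : inv (insert m T) = insert e (insert m T) := by simp only [inv, if_pos h1, if_neg h2]
      rw [h3, hinsE _ h2, hcount T hT, pow_succ]
      ring
  · have h3 : inv S = S := by simp only [inv, if_neg h1]
    rw [h3, hoff S h1]

/-! ### Conclusion -/

lemma moveL'_eq {n : ℕ} (σ : Equiv.Perm (Fin (n + 1))) : moveL' σ = (moveL σ⁻¹)⁻¹ := by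
  change σ * (topCycle (σ⁻¹ (Fin.last n)))⁻¹ = (topCycle (σ⁻¹ (Fin.last n)) * σ⁻¹)⁻¹
  rw [mul_inv_rev, inv_inv]

lemma cycleInv_moveL' {n : ℕ} (σ : Equiv.Perm (Fin (n + 1))) : cycleInv (moveL' σ) = cycleInv σ := by
  rw [moveL'_eq, cycleInv_inv, cycleInv_moveL, cycleInv_inv]

lemma signSum_moveL' {n : ℕ} (σ : Equiv.Perm (Fin (n + 1))) : signSum (moveL' σ) = signSum σ := by
  rw [moveL'_eq, signSum_inv, signSum_moveL, signSum_inv]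

lemma step_invariant {n : ℕ} (σ τ : Equiv.Perm (Fin (n + 1))) (h : RauzyStep σ τ) :
    cycleInv τ = cycleInv σ ∧ signInv τ = signInv σ := by
  unfold signInv
  rcases h with rfl | rfl | rfl | rfl
  · rw [cycleInv_moveL, signSum_moveL]; exact ⟨rfl, rfl⟩
  · rw [cycleInv_moveL', signSum_moveL']; exact ⟨rfl, rfl⟩
  · rw [moveR, cycleInv_rotD, signSum_rotD, cycleInv_moveL, signSum_moveL, cycleInv_rotD,
      signSum_rotD]; exact ⟨rfl, rfl⟩
  · rw [moveR', cycleInv_rotD, signSum_rotD, cycleInv_moveL', signSum_moveL', cycleInv_rotD,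
      signSum_rotD]; exact ⟨rfl, rfl⟩

/-- **Invariance of the invariants.** Each of the four Rauzy moves preserves the cycle invariant
and the sign invariant; consequently all permutations in the same extended Rauzy class have the
same pair of invariants. -/
theorem invariance (n : ℕ) (σ : Equiv.Perm (Fin (n + 1))) :
    (cycleInv (moveL σ) = cycleInv σ ∧ signInv (moveL σ) = signInv σ) ∧
    (cycleInv (moveL' σ) = cycleInv σ ∧ signInv (moveL' σ) = signInv σ) ∧
    (cycleInv (moveR σ) = cycleInv σ ∧ signInv (moveR σ) = signInv σ) ∧
    (cycleInv (moveR' σ) = cycleInv σ ∧ signInv (moveR' σ) = signInv σ) ∧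
    (∀ τ : Equiv.Perm (Fin (n + 1)), RauzyConnected σ τ →
      cycleInv τ = cycleInv σ ∧ signInv τ = signInv σ) := by
  refine ⟨step_invariant _ _ (Or.inl rfl), step_invariant _ _ (Or.inr (Or.inl rfl)),
    step_invariant _ _ (Or.inr (Or.inr (Or.inl rfl))),
    step_invariant _ _ (Or.inr (Or.inr (Or.inr rfl))), ?_⟩
  intro τ h
  unfold RauzyConnected at h
  induction h with
  | rel x y h => exact step_invariant x y h
  | refl x => exact ⟨rfl, rfl⟩
  | symm x y _ ih => exact ⟨ih.1.symm, ih.2.symm⟩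
  | trans x y z _ _ ih1 ih2 => exact ⟨ih2.1.trans ih1.1, ih2.2.trans ih1.2⟩

end Rauzy
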